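/- There exist absolute constants c > 0 and d₀ such that the following holds. Let d ≥ d₀, n ≥ 100d², and (20 log log d)/(log d) < γ < 1/12. Suppose D is an (ε, δ) oblivious subspace embedding over real m×n matrices for d-dimensional subspaces with ε = 1/2 and δ ≤ 1/100, such that every matrix in the support of D has at most s non-zero entries in each column. If m ≤ d^{1+γ}, then s ≥ c/γ. -/

import Mathlib

open MeasureTheory ProbabilityTheory

/-- The Euclidean (ℓ₂) norm of a vector in `Fin k → ℝ`. -/
noncomputable def l2norm {k : ℕ} (v : Fin k → ℝ) : ℝ := Real.sqrt (∑ i, (v i) ^ 2)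

instance matrixMeasurableSpace {m n : ℕ} : MeasurableSpace (Matrix (Fin m) (Fin n) ℝ) :=
  (inferInstance : MeasurableSpace (Fin m → Fin n → ℝ))

/-- `D` is an `(ε, δ)` oblivious subspace embedding distribution over real `m × n`
matrices for `d`-dimensional subspaces of `ℝⁿ`. -/
def IsOSE {m n : ℕ} (d : ℕ) (ε δ : ℝ) (D : Measure (Matrix (Fin m) (Fin n) ℝ)) : Prop :=
  ∀ W : Submodule ℝ (Fin n → ℝ), Module.finrank ℝ W = d →
    ENNReal.ofReal (1 - δ) ≤
      D {Φ | ∀ x ∈ W, (1 - ε) * l2norm x ≤ l2norm (Φ.mulVec x) ∧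
               l2norm (Φ.mulVec x) ≤ (1 + ε) * l2norm x}

/-- Every matrix in the (a.e.) support of `D` has at most `s` non-zero entries per column. -/
def ColSparse {m n : ℕ} (s : ℕ) (D : Measure (Matrix (Fin m) (Fin n) ℝ)) : Prop :=
  ∀ᵐ Φ ∂D, ∀ j : Fin n, (Finset.univ.filter fun i : Fin m => Φ i j ≠ 0).card ≤ s


/-- The matrices that distort no vector with entries in `{-1, 0, 1}` supported on `S` by more than
a factor `1/2`. -/
def signEmbeddings (m : ℕ) {n : ℕ} (S : Finset (Fin n)) : Set (Matrix (Fin m) (Fin n) ℝ) :=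
  {Φ | ∀ v : Fin n → SignType, (∀ j ∉ S, v j = 0) →
    (1 - 1 / 2) * l2norm (fun j => (v j : ℝ)) ≤ l2norm (Φ.mulVec fun j => (v j : ℝ)) ∧
      l2norm (Φ.mulVec fun j => (v j : ℝ)) ≤ (1 + 1 / 2) * l2norm fun j => (v j : ℝ)}

lemma measurableSet_signEmbeddings (m : ℕ) {n : ℕ} (S : Finset (Fin n)) :
    MeasurableSet (signEmbeddings m S) := by
  have hmeas : ∀ x : Fin n → ℝ,
      Measurable fun Φ : Matrix (Fin m) (Fin n) ℝ => l2norm (Φ.mulVec x) := by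
    intro x
    have hentry : ∀ i j, Measurable fun Φ : Matrix (Fin m) (Fin n) ℝ => Φ i j := fun i j =>
      (measurable_pi_apply j).comp (measurable_pi_apply (X := fun _ : Fin m => Fin n → ℝ) i)
    unfold l2norm Matrix.mulVec dotProduct
    exact (Finset.measurable_fun_sum _ fun i _ =>
      (Finset.measurable_fun_sum _ fun j _ => (hentry i j).mul_const _).pow_const 2).sqrt
  unfold signEmbeddings
  simp only [Set.ofPred_forall]
  refine MeasurableSet.iInter fun v => MeasurableSet.iInter fun _ => ?_
  exact (measurableSet_le measurable_const (hmeas _)).inter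
    (measurableSet_le (hmeas _) measurable_const)

/-- A subspace embedding is likely to embed the sign vectors supported on a given small set. -/
lemma IsOSE.le_measure_signEmbeddings {d m n : ℕ} {δ : ℝ} {D : Measure (Matrix (Fin m) (Fin n) ℝ)}
    (hD : IsOSE d (1 / 2) δ D) (hdn : d ≤ n) {S : Finset (Fin n)} (hS : S.card ≤ d) :
    ENNReal.ofReal (1 - δ) ≤ D (signEmbeddings m S) := by
  obtain ⟨T, hST, hT⟩ := Finset.exists_superset_card_eq hS (by simpa using hdn)
  have hli : LinearIndependent ℝ fun j : T => (Pi.single (j : Fin n) (1 : ℝ) : Fin n → ℝ) := by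
    have := (Pi.basisFun ℝ (Fin n)).linearIndependent.comp ((↑) : T → Fin n) Subtype.val_injective
    convert this using 2
    simp
  refine (hD _ ((finrank_span_eq_card hli).trans (by simpa using hT))).trans (measure_mono ?_)
  intro Φ hΦ v hv
  refine hΦ _ ?_
  have hsum : (fun j => (v j : ℝ)) = ∑ j : T, (v j : ℝ) • (Pi.single (j : Fin n) (1 : ℝ)) := by
    rw [Finset.sum_coe_sort T fun j => (v j : ℝ) • (Pi.single j (1 : ℝ) : Fin n → ℝ)]
    ext i
    simp only [Finset.sum_apply, Pi.smul_apply, Pi.single_apply, smul_eq_mul, mul_ite, mul_one,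
      mul_zero, Finset.sum_ite_eq]
    split_ifs with hi
    · rfl
    · rw [hv i fun h => hi (hST h)]; simp
  rw [hsum]
  exact Submodule.sum_mem _ fun j _ =>
    Submodule.smul_mem _ _ (Submodule.subset_span (Set.mem_range_self j))

lemma sq_l2norm {k : ℕ} (v : Fin k → ℝ) : l2norm v ^ 2 = ∑ i, v i ^ 2 :=
  Real.sq_sqrt (Finset.sum_nonneg fun _ _ => sq_nonneg _)

lemma l2norm_nonneg {k : ℕ} (v : Fin k → ℝ) : 0 ≤ l2norm v := Real.sqrt_nonneg _

/-- In an `s`-sparse matrix preserving the norm of a basis vector up to a factor `1/2`, the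
corresponding column has a large entry. -/
lemma exists_large_entry {m n s : ℕ} {Φ : Matrix (Fin m) (Fin n) ℝ} {S : Finset (Fin n)}
    (hΦ : Φ ∈ signEmbeddings m S) {j : Fin n} (hj : j ∈ S)
    (hs : (Finset.univ.filter fun i : Fin m => Φ i j ≠ 0).card ≤ s) :
    ∃ i, 1 ≤ 4 * s * Φ i j ^ 2 := by
  by_contra! hlt
  have hv := (hΦ (Pi.single j 1) fun j' hj' => by
    rw [Pi.single_eq_of_ne]; rintro rfl; exact hj' hj).1
  have hx : (fun j' => ((Pi.single j 1 : Fin n → SignType) j' : ℝ)) = Pi.single j 1 := by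
    ext j'
    by_cases h : j' = j
    · subst h; simp
    · simp [h]
  rw [hx, Matrix.mulVec_single_one] at hv
  have h1 : l2norm (Pi.single j 1 : Fin n → ℝ) = 1 := by
    simp [l2norm, Pi.single_apply]
  rw [h1] at hv
  have h2 : (1 / 4 : ℝ) ≤ ∑ i, Φ i j ^ 2 := by
    have := sq_l2norm (Φ.col j)
    simp only [Matrix.col_apply] at this
    rw [← this]
    nlinarith
  set A := Finset.univ.filter fun i : Fin m => Φ i j ≠ 0
  have h3 : ∑ i, Φ i j ^ 2 = ∑ i ∈ A, Φ i j ^ 2 := by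
    symm
    refine Finset.sum_subset (Finset.subset_univ _) fun i _ hi => ?_
    simp only [A, Finset.mem_filter, Finset.mem_univ, true_and, not_not] at hi
    rw [hi]; norm_num
  have hA : A.Nonempty := by
    by_contra h
    rw [Finset.not_nonempty_iff_eq_empty] at h
    rw [h3, h] at h2
    norm_num at h2
  have h4 : ∑ i ∈ A, 4 * s * Φ i j ^ 2 < ∑ i ∈ A, (1 : ℝ) :=
    Finset.sum_lt_sum_of_nonempty hA fun i _ => hlt i
  rw [← Finset.mul_sum, ← h3] at h4
  simp only [Finset.sum_const, nsmul_eq_mul, mul_one] at h4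
  have h5 : (A.card : ℝ) ≤ s := by exact_mod_cast hs
  have h6 : (0 : ℝ) ≤ s := Nat.cast_nonneg s
  nlinarith

/-- A matrix preserving the norms of sign vectors has few large entries in each row. -/
lemma card_le_of_large_row {m n s : ℕ} {Φ : Matrix (Fin m) (Fin n) ℝ} {S T : Finset (Fin n)}
    (hΦ : Φ ∈ signEmbeddings m S) (hTS : T ⊆ S) (i : Fin m)
    (hT : ∀ j ∈ T, 1 ≤ 4 * s * Φ i j ^ 2) : T.card ≤ 9 * s := by
  let v : Fin n → SignType := fun j => if j ∈ T then SignType.sign (Φ i j) else 0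
  have hv := (hΦ v fun j hj => if_neg fun h => hj (hTS h)).2
  have hne : ∀ j ∈ T, Φ i j ≠ 0 := by
    intro j hj h0
    have := hT j hj
    rw [h0] at this
    norm_num at this
  have hnorm : l2norm (fun j => (v j : ℝ)) ^ 2 = T.card := by
    rw [sq_l2norm, ← Finset.sum_subset (Finset.subset_univ T)]
    · rw [Finset.sum_congr rfl fun j hj => show (v j : ℝ) ^ 2 = 1 from ?_]
      · simp
      · simp only [v, if_pos hj]
        rcases lt_or_gt_of_ne (hne j hj) with h | h <;> simp [h]
    · intro j _ hj; simp [v, hj]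
  have hrow : Φ.mulVec (fun j => (v j : ℝ)) i = ∑ j ∈ T, |Φ i j| := by
    simp only [Matrix.mulVec, dotProduct]
    rw [← Finset.sum_subset (Finset.subset_univ T)]
    · exact Finset.sum_congr rfl fun j hj => by simp [v, hj]
    · intro j _ hj; simp [v, hj]
  have h1 : (∑ j ∈ T, |Φ i j|) ^ 2 ≤ l2norm (Φ.mulVec fun j => (v j : ℝ)) ^ 2 := by
    rw [sq_l2norm, ← hrow]
    exact Finset.single_le_sum (f := fun i => (Φ.mulVec (fun j => (v j : ℝ)) i) ^ 2)
      (fun _ _ => sq_nonneg _) (Finset.mem_univ i)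
  have h2 : l2norm (Φ.mulVec fun j => (v j : ℝ)) ^ 2 ≤ 9 / 4 * T.card := by
    rw [← hnorm]
    nlinarith [l2norm_nonneg (Φ.mulVec fun j => (v j : ℝ)), l2norm_nonneg fun j => (v j : ℝ)]
  have hs0 : (0 : ℝ) ≤ s := Nat.cast_nonneg s
  have h3 : (T.card : ℝ) ≤ 2 * Real.sqrt s * ∑ j ∈ T, |Φ i j| := by
    rw [Finset.mul_sum, Finset.cast_card]
    refine Finset.sum_le_sum fun j hj => ?_
    rw [← Real.sqrt_one, show (2 : ℝ) * Real.sqrt s * |Φ i j| = Real.sqrt (4 * s * Φ i j ^ 2) by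
      rw [Real.sqrt_mul (by positivity), Real.sqrt_mul (by norm_num), Real.sqrt_sq_eq_abs,
        show (4 : ℝ) = 2 ^ 2 by norm_num, Real.sqrt_sq (by norm_num)]]
    exact Real.sqrt_le_sqrt (hT j hj)
  have h4 : (T.card : ℝ) ^ 2 ≤ 4 * s * (9 / 4 * T.card) := by
    calc (T.card : ℝ) ^ 2 ≤ (2 * Real.sqrt s * ∑ j ∈ T, |Φ i j|) ^ 2 := by gcongr
      _ = 4 * s * (∑ j ∈ T, |Φ i j|) ^ 2 := by
        rw [mul_pow, mul_pow, Real.sq_sqrt hs0]; norm_num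
      _ ≤ _ := by gcongr; exact h1.trans h2
  rcases Nat.eq_zero_or_pos T.card with h0 | hpos
  · omega
  have : (0 : ℝ) < T.card := by exact_mod_cast hpos
  have h5 : (T.card : ℝ) ≤ 9 * s := by nlinarith
  exact_mod_cast h5
/-- Under a product of probability measures on `Bool`, events that are determined by disjoint
sets of coordinates are independent. -/
lemma pi_real_inter_eq_mul {ι : Type*} [Fintype ι] [DecidableEq ι] (ν : Measure Bool)
    [IsProbabilityMeasure ν] {S T : Finset ι} (hST : Disjoint S T) {E F : Set (ι → Bool)}
    (hE : ∀ ω ω', (∀ i ∈ S, ω i = ω' i) → ω ∈ E → ω' ∈ E)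
    (hF : ∀ ω ω', (∀ i ∈ T, ω i = ω' i) → ω ∈ F → ω' ∈ F) :
    (Measure.pi fun _ : ι => ν).real (E ∩ F) =
      (Measure.pi fun _ : ι => ν).real E * (Measure.pi fun _ : ι => ν).real F := by
  have hind : iIndepFun (fun (i : ι) (ω : ι → Bool) => ω i) (Measure.pi fun _ : ι => ν) :=
    iIndepFun_pi (X := fun _ => id) (fun _ => aemeasurable_id)
  have h := hind.indepFun_finset S T hST (fun i => measurable_pi_apply i)
  have hpre : ∀ (S : Finset ι) (E : Set (ι → Bool)),
      (∀ ω ω', (∀ i ∈ S, ω i = ω' i) → ω ∈ E → ω' ∈ E) →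
      Set.preimage (fun (ω : ι → Bool) (i : S) => ω i) (Set.image (fun ω (i : S) => ω i) E) = E := by
    intro S E hE
    refine Set.Subset.antisymm ?_ (Set.subset_preimage_image _ _)
    rintro ω ⟨ω', hω', h⟩
    exact hE ω' ω (fun i hi => congrFun h ⟨i, hi⟩) hω'
  have := h.measure_inter_preimage_eq_mul _ _
    (Set.toFinite (Set.image (fun ω (i : S) => ω i) E)).measurableSet
    (Set.toFinite (Set.image (fun ω (i : T) => ω i) F)).measurableSet
  rw [hpre S E hE, hpre T F hF] at this
  simp only [Measure.real, this, ENNReal.toReal_mul]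

/-- Under a product of probability measures on `Bool`, a family of events that are determined by
pairwise disjoint sets of coordinates is independent. -/
lemma pi_real_forall_eq_prod {ι β : Type*} [Fintype ι] [DecidableEq ι] [Fintype β]
    (ν : Measure Bool) [IsProbabilityMeasure ν] {T : β → Finset ι}
    (hT : Pairwise fun b b' => Disjoint (T b) (T b')) {E : β → Set (ι → Bool)}
    (hE : ∀ b ω ω', (∀ i ∈ T b, ω i = ω' i) → ω ∈ E b → ω' ∈ E b) :
    (Measure.pi fun _ : ι => ν).real {ω | ∀ b, ω ∈ E b} =
      ∏ b, (Measure.pi fun _ : ι => ν).real (E b) := by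
  classical
  suffices h : ∀ B : Finset β, (Measure.pi fun _ : ι => ν).real {ω | ∀ b ∈ B, ω ∈ E b} =
      ∏ b ∈ B, (Measure.pi fun _ : ι => ν).real (E b) by
    simpa using h Finset.univ
  intro B
  induction B using Finset.induction_on with
  | empty => simp
  | insert a B ha ih =>
    have hset : {ω | ∀ b ∈ insert a B, ω ∈ E b} = E a ∩ {ω | ∀ b ∈ B, ω ∈ E b} := by
      ext ω; simp
    rw [Finset.prod_insert ha, ← ih, hset]
    refine pi_real_inter_eq_mul ν (S := T a) (T := B.biUnion T) ?_ (hE a) ?_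
    · rw [Finset.disjoint_biUnion_right]
      exact fun b hb => hT (by rintro rfl; exact ha hb)
    · intro ω ω' h hω b hb
      exact hE b ω ω' (fun i hi => h i (Finset.mem_biUnion.2 ⟨b, hb, hi⟩)) (hω b hb)

/-- The probability that a random set, containing every coordinate independently with probability
`1 - ν {false}`, fails to hit all the parts of each of `R` blocks of `k` parts of size `l`. -/
lemma pi_real_forall_exists_forall_eq_false {ι : Type*} [Fintype ι] [DecidableEq ι]
    (ν : Measure Bool) [IsProbabilityMeasure ν] {R k l : ℕ}
    {e : Fin R × Fin k × Fin l → ι} (he : Function.Injective e) :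
    (Measure.pi fun _ : ι => ν).real {ω | ∀ b, ∃ i, ∀ j, ω (e (b, i, j)) = false} =
      (1 - (1 - ν.real {false} ^ l) ^ k) ^ R := by
  set P := Measure.pi fun _ : ι => ν
  have hmeas : ∀ s : Set (ι → Bool), MeasurableSet s := fun s => (Set.toFinite s).measurableSet
  have hcell : ∀ b i, P.real {ω | ∀ j, ω (e (b, i, j)) = false} = ν.real {false} ^ l := by
    intro b i
    have := Measure.pi_pi_finset (fun _ : ι => ν) (fun _ => {false})
      (Finset.univ.image fun j => e (b, i, j))
    rw [Finset.prod_image (fun j _ j' _ h => by simpa using he h)] at this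
    have hset : {ω : ι → Bool | ∀ j, ω (e (b, i, j)) = false} =
        ((Finset.univ.image fun j => e (b, i, j) : Finset ι) : Set ι).pi fun _ => {false} := by
      ext ω; simp [Set.mem_pi]
    rw [hset, Measure.real, this]
    simp [Measure.real]
  have hblock : ∀ b, P.real {ω | ∀ i, ω ∈ {ω : ι → Bool | ∀ j, ω (e (b, i, j)) = false}ᶜ} =
      (1 - ν.real {false} ^ l) ^ k := by
    intro b
    rw [pi_real_forall_eq_prod ν (T := fun i => Finset.univ.image fun j => e (b, i, j))]
    · rw [Finset.prod_congr rfl fun i _ =>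
        (probReal_compl_eq_one_sub (hmeas _)).trans (congrArg (1 - ·) (hcell b i))]
      simp
    · intro i i' hii'
      simp only [Finset.disjoint_left, Finset.mem_image, Finset.mem_univ, true_and]
      rintro _ ⟨j, rfl⟩ ⟨j', h⟩
      have := he h
      simp only [Prod.mk.injEq] at this
      exact hii' this.2.1.symm
    · intro i ω ω' h hω hω'
      exact hω fun j => by rw [h _ (Finset.mem_image_of_mem _ (Finset.mem_univ j))]; exact hω' j
  have hset : {ω : ι → Bool | ∀ b, ∃ i, ∀ j, ω (e (b, i, j)) = false} =
      {ω | ∀ b, ω ∈ {ω : ι → Bool |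
        ∀ i, ω ∈ {ω : ι → Bool | ∀ j, ω (e (b, i, j)) = false}ᶜ}ᶜ} := by
    ext ω; simp
  rw [hset, pi_real_forall_eq_prod ν
    (T := fun b => Finset.univ.image fun p : Fin k × Fin l => e (b, p))]
  · rw [Finset.prod_congr rfl fun b _ =>
      (probReal_compl_eq_one_sub (hmeas _)).trans (congrArg (1 - ·) (hblock b))]
    simp
  · intro b b' hbb'
    simp only [Finset.disjoint_left, Finset.mem_image, Finset.mem_univ, true_and]
    rintro _ ⟨j, rfl⟩ ⟨j', h⟩
    have := he h
    simp only [Prod.mk.injEq] at this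
    exact hbb' this.1.symm
  · intro b ω ω' h hω hω'
    refine hω fun i hi => hω' i fun j => ?_
    rw [← h _ (Finset.mem_image_of_mem _ (Finset.mem_univ (i, j)))]
    exact hi j

/-- Pigeonhole: a large enough type with a colouring by few colours contains many disjoint
monochromatic sets of a prescribed size. -/
lemma exists_disjoint_monochromatic {α κ : Type*} [Fintype α] [DecidableEq α] [Fintype κ]
    [DecidableEq κ] [Nonempty κ] (h : α → κ) (L R : ℕ)
    (hcard : (R + Fintype.card κ) * L ≤ Fintype.card α) :
    ∃ T : ℕ → Finset α, (∀ b < R, (T b).card = L) ∧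
      (∀ b < R, ∀ b' < R, b ≠ b' → Disjoint (T b) (T b')) ∧
      ∀ b < R, ∃ c, ∀ j ∈ T b, h j = c := by
  induction R with
  | zero => exact ⟨fun _ => ∅, by simp, by simp, by simp⟩
  | succ R ih =>
    obtain ⟨T, hT, hdisj, hmono⟩ := ih (le_trans (by gcongr; omega) hcard)
    set U := (Finset.range R).biUnion T
    have hU : U.card ≤ R * L := by
      refine Finset.card_biUnion_le.trans ?_
      rw [Finset.sum_congr rfl fun b hb => hT b (Finset.mem_range.1 hb)]
      simp
    have hUc : Fintype.card κ * L ≤ Uᶜ.card := by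
      rw [Finset.card_compl]
      have : (R + 1 + Fintype.card κ) * L = R * L + L + Fintype.card κ * L := by ring
      omega
    obtain ⟨c, -, hc⟩ := Finset.exists_le_card_fiber_of_mul_le_card_of_maps_to (s := Uᶜ)
      (t := Finset.univ) (f := h) (fun _ _ => Finset.mem_univ _) Finset.univ_nonempty
      (by simpa using hUc)
    obtain ⟨A, hA, hAcard⟩ := Finset.exists_subset_card_eq hc
    have hAT : ∀ b < R, Disjoint A (T b) := by
      intro b hb
      rw [Finset.disjoint_left]
      intro j hj hjb
      have := hA hj
      simp only [Finset.mem_filter, Finset.mem_compl] at this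
      exact this.1 (Finset.mem_biUnion.2 ⟨b, Finset.mem_range.2 hb, hjb⟩)
    have hTlt : ∀ b < R, Function.update T R A b = T b := fun b hb =>
      Function.update_of_ne hb.ne _ _
    refine ⟨Function.update T R A, ?_, ?_, ?_⟩
    · intro b hb
      rcases Nat.lt_succ_iff_lt_or_eq.1 hb with hb | rfl
      · rw [hTlt b hb, hT b hb]
      · simpa using hAcard
    · intro b hb b' hb' hne
      rcases Nat.lt_succ_iff_lt_or_eq.1 hb with hb | rfl <;>
        rcases Nat.lt_succ_iff_lt_or_eq.1 hb' with hb' | rfl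
      · rw [hTlt b hb, hTlt b' hb']; exact hdisj b hb b' hb' hne
      · rw [hTlt b hb, Function.update_self]; exact (hAT b hb).symm
      · rw [hTlt b' hb', Function.update_self]; exact hAT b' hb'
      · exact absurd rfl hne
    · intro b hb
      rcases Nat.lt_succ_iff_lt_or_eq.1 hb with hb | rfl
      · rw [hTlt b hb]; exact hmono b hb
      · refine ⟨c, fun j hj => ?_⟩
        rw [Function.update_self] at hj
        exact (Finset.mem_filter.1 (hA hj)).2

/-- `exists_disjoint_monochromatic` with every monochromatic set cut into `k` parts of size `l`. -/
lemma exists_injective_monochromatic {α κ : Type*} [Fintype α] [DecidableEq α] [Fintype κ]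
    [DecidableEq κ] [Nonempty κ] (h : α → κ) (R k l : ℕ)
    (hcard : (R + Fintype.card κ) * (k * l) ≤ Fintype.card α) :
    ∃ e : Fin R × Fin k × Fin l → α, Function.Injective e ∧ ∀ b, ∃ c, ∀ p, h (e (b, p)) = c := by
  obtain ⟨T, hT, hdisj, hmono⟩ := exists_disjoint_monochromatic h (k * l) R hcard
  let g (b : Fin R) : Fin (k * l) ≃ T b := ((T b).equivFinOfCardEq (hT b b.2)).symm
  refine ⟨fun x => g x.1 (finProdFinEquiv x.2), ?_, ?_⟩
  · rintro ⟨b, p⟩ ⟨b', p'⟩ hx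
    obtain rfl : b = b' := by
      by_contra hne
      have hd := hdisj b b.2 b' b'.2 (fun h => hne (Fin.ext h))
      refine Finset.disjoint_left.1 hd (g b (finProdFinEquiv p)).2 ?_
      simp only at hx
      rw [hx]
      exact Subtype.property _
    simpa using (g b).injective (Subtype.ext hx)
  · intro b
    obtain ⟨c, hc⟩ := hmono b b.2
    exact ⟨c, fun p => hc _ (Subtype.property _)⟩

/-- The set of coordinates at which a Boolean vector is true. -/
def trueSet {n : ℕ} (ω : Fin n → Bool) : Finset (Fin n) := Finset.univ.filter fun j => ω j = true

/-- Markov's inequality for the size of a random set. -/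
lemma pi_real_lt_card_trueSet_le {n d : ℕ} (hd : 0 < d) (ν : Measure Bool) [IsProbabilityMeasure ν]
    (hν : n * ν.real {true} ≤ d / 4) :
    (Measure.pi fun _ : Fin n => ν).real {ω | d ≤ (trueSet ω).card} ≤ 1 / 4 := by
  set P := Measure.pi fun _ : Fin n => ν
  have hint : ∫ ω, ((trueSet ω).card : ℝ) ∂P = n * ν.real {true} := by
    have hcard : ∀ ω : Fin n → Bool, ((trueSet ω).card : ℝ) =
        ∑ j, {ω : Fin n → Bool | ω j = true}.indicator (fun _ => (1 : ℝ)) ω := by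
      intro ω
      simp [trueSet, Set.indicator_apply]
    simp_rw [hcard]
    rw [integral_finsetSum _ fun j _ => Integrable.of_finite]
    have hj : ∀ j : Fin n, ∫ ω, {ω : Fin n → Bool | ω j = true}.indicator (fun _ => (1 : ℝ)) ω ∂P =
        ν.real {true} := by
      intro j
      rw [integral_indicator_const _ (Set.toFinite _).measurableSet, smul_eq_mul, mul_one,
        Measure.real, Measure.real]
      congr 1
      have := (measurePreserving_eval (fun _ : Fin n => ν) j).measure_preimage
        (s := {true}) (measurableSet_singleton _).nullMeasurableSet
      rw [← this]
      rfl
    rw [Finset.sum_congr rfl fun j _ => hj j]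
    simp
  have hmarkov := mul_meas_ge_le_integral_of_nonneg (μ := P)
    (f := fun ω => ((trueSet ω).card : ℝ)) (Filter.Eventually.of_forall fun _ => Nat.cast_nonneg _)
    Integrable.of_finite (d : ℝ)
  rw [hint] at hmarkov
  simp only [Nat.cast_le] at hmarkov
  have : (0 : ℝ) < d := by exact_mod_cast hd
  nlinarith

/-- A sparse matrix that embeds the sign vectors supported on a set `S` has a colouring of its
columns such that `S` does not contain many columns of one colour. -/
lemma setOf_mem_signEmbeddings_subset {m n s R l : ℕ} {Φ : Matrix (Fin m) (Fin n) ℝ}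
    (hs : ∀ j : Fin n, (Finset.univ.filter fun i : Fin m => Φ i j ≠ 0).card ≤ s)
    (hcard : (R + (m + 1)) * ((9 * s + 1) * l) ≤ n) :
    ∃ e : Fin R × Fin (9 * s + 1) × Fin l → Fin n, Function.Injective e ∧
      {ω : Fin n → Bool | Φ ∈ signEmbeddings m (trueSet ω)} ⊆
        {ω | ∀ b, ∃ i, ∀ j, ω (e (b, i, j)) = false} := by
  classical
  let h : Fin n → Option (Fin m) := fun j =>
    if hj : ∃ i, 1 ≤ 4 * s * Φ i j ^ 2 then some hj.choose else none
  obtain ⟨e, he, hmono⟩ := exists_injective_monochromatic h R (9 * s + 1) l (by simpa using hcard)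
  refine ⟨e, he, fun ω hω b => ?_⟩
  by_contra! hex
  choose J hJ using hex
  simp only [ne_eq, Bool.not_eq_false] at hJ
  obtain ⟨c, hc⟩ := hmono b
  have hmem : ∀ i, e (b, i, J i) ∈ trueSet ω := fun i => by simp [trueSet, hJ i]
  have hlarge : ∀ i, ∃ r, 1 ≤ 4 * s * Φ r (e (b, i, J i)) ^ 2 := fun i =>
    exists_large_entry hω (hmem i) (hs _)
  have hsome : ∀ i, c = some (hlarge i).choose := fun i => by
    rw [← hc (i, J i)]
    exact dif_pos (hlarge i)
  have hle := card_le_of_large_row (s := s) hω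
    (T := Finset.univ.image fun i => e (b, i, J i)) (i := (hlarge 0).choose)
    (by
      intro j hj
      obtain ⟨i, -, rfl⟩ := Finset.mem_image.1 hj
      exact hmem i)
    (by
      intro j hj
      obtain ⟨i, -, rfl⟩ := Finset.mem_image.1 hj
      have hi : (hlarge 0).choose = (hlarge i).choose :=
        Option.some_injective _ ((hsome 0).symm.trans (hsome i))
      rw [hi]
      exact (hlarge i).choose_spec)
  rw [Finset.card_image_of_injective _ fun i i' h => by
    have := he h
    simp only [Prod.mk.injEq, true_and] at this
    exact this.1] at hle
  simp at hle

/-- The existence of a sparse subspace embedding with few rows bounds from below the probability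
that a random set of columns contains few columns of every colour. -/
lemma IsOSE.le_pow_of_colSparse {d m n s R l : ℕ} {δ : ℝ} {D : Measure (Matrix (Fin m) (Fin n) ℝ)}
    [IsProbabilityMeasure D] (hD : IsOSE d (1 / 2) δ D) (hs : ColSparse s D) (hδ : δ ≤ 1 / 100)
    (hd : 0 < d) (hdn : d ≤ n) (hcard : (R + (m + 1)) * ((9 * s + 1) * l) ≤ n)
    (p : unitInterval) (hp : n * (p : ℝ) ≤ d / 4) :
    (99 / 100 * (3 / 4) : ℝ) ≤ (1 - (1 - (1 - (p : ℝ)) ^ l) ^ (9 * s + 1)) ^ R := by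
  set ν : Measure Bool := bernoulliMeasure true false p
  have hνt : ν.real {true} = p :=
    bernoulliMeasure_real_apply_of_mem_of_notMem p (measurableSet_singleton _) rfl (by simp)
  have hνf : ν.real {false} = 1 - p :=
    bernoulliMeasure_real_apply_of_notMem_of_mem p (measurableSet_singleton _) (by simp) rfl
  set P : Measure (Fin n → Bool) := Measure.pi fun _ => ν
  set c : ℝ := (1 - (1 - (1 - (p : ℝ)) ^ l) ^ (9 * s + 1)) ^ R
  have hmeas : MeasurableSet {x : (Fin n → Bool) × Matrix (Fin m) (Fin n) ℝ |
      x.2 ∈ signEmbeddings m (trueSet x.1)} :=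
    measurableSet_setOfPred.2 (measurable_from_prod_countable_right fun ω =>
      measurableSet_setOfPred.1 (measurableSet_signEmbeddings m (trueSet ω)))
  have hupper : P.prod D {x | x.2 ∈ signEmbeddings m (trueSet x.1)} ≤ ENNReal.ofReal c := by
    rw [Measure.prod_apply_symm hmeas]
    calc _ ≤ ∫⁻ _, ENNReal.ofReal c ∂D := by
          refine lintegral_mono_ae ?_
          filter_upwards [hs] with Φ hΦ
          obtain ⟨e, he, hsub⟩ := setOf_mem_signEmbeddings_subset hΦ hcard
          refine (measure_mono hsub).trans ?_
          rw [← ofReal_measureReal, pi_real_forall_exists_forall_eq_false ν he, hνf]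
      _ = ENNReal.ofReal c := by simp
  have hlower : ENNReal.ofReal (99 / 100 * (3 / 4)) ≤
      P.prod D {x | x.2 ∈ signEmbeddings m (trueSet x.1)} := by
    rw [Measure.prod_apply hmeas]
    have hsmall : ENNReal.ofReal (3 / 4) ≤ P {ω | d ≤ (trueSet ω).card}ᶜ := by
      rw [← ofReal_measureReal, probReal_compl_eq_one_sub (Set.toFinite _).measurableSet]
      refine ENNReal.ofReal_le_ofReal ?_
      have := pi_real_lt_card_trueSet_le hd ν (hνt ▸ hp)
      linarith
    calc ENNReal.ofReal (99 / 100 * (3 / 4))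
        = ENNReal.ofReal (99 / 100) * ENNReal.ofReal (3 / 4) := ENNReal.ofReal_mul (by norm_num)
      _ ≤ ENNReal.ofReal (99 / 100) * P {ω | d ≤ (trueSet ω).card}ᶜ := by gcongr
      _ = ∫⁻ _ in {ω | d ≤ (trueSet ω).card}ᶜ, ENNReal.ofReal (99 / 100) ∂P := by
        rw [setLIntegral_const]
      _ ≤ ∫⁻ ω in {ω | d ≤ (trueSet ω).card}ᶜ, D (signEmbeddings m (trueSet ω)) ∂P := by
        refine setLIntegral_mono' (Set.toFinite _).measurableSet fun ω hω => ?_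
        refine (ENNReal.ofReal_le_ofReal (by linarith)).trans
          (hD.le_measure_signEmbeddings hdn (S := trueSet ω) ?_)
        simp only [Set.mem_compl_iff, Set.mem_ofPred_eq, not_le] at hω
        exact hω.le
      _ ≤ ∫⁻ ω, D (signEmbeddings m (trueSet ω)) ∂P := setLIntegral_le_lintegral _ _
  have hle := hlower.trans hupper
  by_contra! hlt
  refine absurd hle (not_le.2 ((ENNReal.ofReal_lt_ofReal_iff (by norm_num)).2 hlt))

lemma one_sub_pow_le_one_div {t : ℝ} (h0 : 0 ≤ t) (h1 : t ≤ 1) (N : ℕ) :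
    (1 - t) ^ N ≤ 1 / (1 + N * t) := by
  have hpos : 0 < 1 + N * t := by positivity
  calc (1 - t) ^ N ≤ Real.exp (-t) ^ N :=
        pow_le_pow_left₀ (by linarith) (Real.one_sub_le_exp_neg t) N
    _ = 1 / Real.exp (N * t) := by
        rw [← Real.exp_nat_mul, mul_neg, Real.exp_neg, one_div]
    _ ≤ 1 / (1 + N * t) := by
        refine one_div_le_one_div_of_le hpos ?_
        linarith [Real.add_one_le_exp (N * t)]

/-- With hitting probabilities that are not too small, some block is likely to be hit in all its
parts. -/
lemma one_sub_pow_lt {x y γ r : ℝ} {k M : ℕ} (hx : 4 ≤ x) (hkγ : k * γ ≤ 11 / 24)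
    (hky : k * y ≤ x / 40) (hM : Real.exp x ≤ M) (hr : Real.exp (-(γ * x) - 2 * y) ≤ r)
    (hr1 : r ≤ 1) : (1 - r ^ k) ^ M < 99 / 100 * (3 / 4) := by
  have hr0 : 0 ≤ r := (Real.exp_pos _).le.trans hr
  have hexp : Real.exp (-(11 / 24 * x) - x / 20) ≤ r ^ k := by
    calc Real.exp (-(11 / 24 * x) - x / 20) ≤ Real.exp (k * (-(γ * x) - 2 * y)) := by
          refine Real.exp_le_exp.2 ?_
          nlinarith
      _ = Real.exp (-(γ * x) - 2 * y) ^ k := Real.exp_nat_mul _ _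
      _ ≤ r ^ k := by gcongr
  have hlarge : 2 ≤ M * r ^ k := by
    calc (2 : ℝ) ≤ Real.exp (x + (-(11 / 24 * x) - x / 20)) := by
          refine le_trans ?_ (Real.add_one_le_exp _)
          linarith
      _ = Real.exp x * Real.exp (-(11 / 24 * x) - x / 20) := Real.exp_add _ _
      _ ≤ M * r ^ k := by gcongr
  calc (1 - r ^ k) ^ M ≤ 1 / (1 + M * r ^ k) :=
        one_sub_pow_le_one_div (by positivity) (pow_le_one₀ hr0 hr1) M
    _ ≤ 1 / (1 + 2) := by gcongr
    _ < 99 / 100 * (3 / 4) := by norm_num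

/-- A random set of density `d / (4n)` hits a set of `n / (2N)` coordinates with probability at
least `d / (32N)`. -/
lemma div_le_one_sub_pow {d n N : ℕ} (hd : 0 < d) (hdN : d ≤ N) (hn : 4 * N ≤ n) :
    (d / (32 * N) : ℝ) ≤ 1 - (1 - d / (4 * n) : ℝ) ^ (n / (2 * N)) := by
  have hN : (0 : ℝ) < N := by exact_mod_cast hd.trans_le hdN
  have hd' : (0 : ℝ) < d := by exact_mod_cast hd
  have hdN' : (d : ℝ) ≤ N := by exact_mod_cast hdN
  have hn' : (4 * N : ℝ) ≤ n := by exact_mod_cast hn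
  have hn0 : (0 : ℝ) < n := by linarith
  set l := n / (2 * N)
  have hlu : (l : ℝ) * (2 * N) ≤ n := by exact_mod_cast Nat.div_mul_le_self n (2 * N)
  have hll : (n : ℝ) ≤ l * (4 * N) := by
    have h : n < (l + 1) * (2 * N) := by
      have := Nat.lt_div_mul_add (a := n) (b := 2 * N) (by omega)
      rw [add_mul, one_mul]
      exact this
    have h' : (n : ℝ) < (l + 1) * (2 * N) := by exact_mod_cast h
    nlinarith
  have hp1 : (d / (4 * n) : ℝ) ≤ 1 := by
    rw [div_le_one (by positivity)]; linarith
  have hpow := one_sub_pow_le_one_div (by positivity) hp1 l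
  set u : ℝ := l * (d / (4 * n))
  have hu1 : u ≤ 1 := by
    have : u = l * d / (4 * n) := by ring
    rw [this, div_le_one (by positivity)]
    nlinarith [mul_le_mul_of_nonneg_left hdN' (Nat.cast_nonneg (α := ℝ) l)]
  have hu : d / (16 * N) ≤ u := by
    have : u = l * d / (4 * n) := by ring
    rw [this, div_le_div_iff₀ (by positivity) (by positivity)]
    nlinarith
  have hu0 : 0 ≤ u := by positivity
  have hfrac : u / 2 ≤ 1 - 1 / (1 + u) := by
    rw [le_sub_iff_add_le, ← le_sub_iff_add_le', div_le_iff₀ (by positivity)]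
    nlinarith
  have : (d / (32 * N) : ℝ) = d / (16 * N) / 2 := by ring
  rw [this]
  linarith

/-- If `M` is at most `3 d ^ (1 + γ)` and `k` is at most logarithmic in `d`, then `d / (32 M k)` is
not much smaller than `d ^ (-γ)`. -/
lemma exp_neg_sub_le_div {d x y γ : ℝ} {k M : ℕ} (hd : 0 < d) (hxy : Real.exp y = x) (hx : 4 ≤ x)
    (hk : 80 * (k : ℝ) ≤ x) (hM : (M : ℝ) ≤ 3 * (d * Real.exp (γ * x))) (hMk : 0 < M * k) :
    Real.exp (-(γ * x) - 2 * y) ≤ d / (32 * (M * k : ℕ)) := by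
  have hMk' : (0 : ℝ) < 32 * (M * k : ℕ) := by
    have : (0 : ℝ) < (M * k : ℕ) := by exact_mod_cast hMk
    linarith
  have hden : (32 * (M * k : ℕ) : ℝ) ≤ d * Real.exp (γ * x) * x ^ 2 := by
    push_cast
    calc (32 * (M * k) : ℝ) ≤ 32 * (3 * (d * Real.exp (γ * x)) * k) := by gcongr
      _ = d * Real.exp (γ * x) * (96 * k) := by ring
      _ ≤ d * Real.exp (γ * x) * x ^ 2 := by
        gcongr
        nlinarith
  have hsq : Real.exp (2 * y) = x ^ 2 := by
    rw [← hxy, ← Real.exp_nat_mul]; norm_num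
  calc Real.exp (-(γ * x) - 2 * y) = d / (d * Real.exp (γ * x) * x ^ 2) := by
        rw [Real.exp_sub, Real.exp_neg, hsq]
        field_simp
    _ ≤ d / (32 * (M * k : ℕ)) := by gcongr

theorem stmt10 :
    ∃ c : ℝ, 0 < c ∧ ∃ d₀ : ℕ,
      ∀ (d n m s : ℕ) (γ δ : ℝ) (D : Measure (Matrix (Fin m) (Fin n) ℝ)),
        IsProbabilityMeasure D →
        d₀ ≤ d → 100 * d ^ 2 ≤ n →
        20 * Real.log (Real.log d) / Real.log d < γ → γ < 1/12 →
        0 ≤ δ → δ ≤ 1/100 →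
        IsOSE d (1/2) δ D →
        ColSparse s D →
        (m : ℝ) ≤ (d : ℝ) ^ ((1:ℝ) + γ) →
        c / γ ≤ (s : ℝ) := by
  refine ⟨1 / 24, by norm_num, ⌈Real.exp (Real.exp 2)⌉₊, ?_⟩
  intro d n m s γ δ D _ hd hn hγ hγ' _ hδ hD hs hm
  have hdexp : Real.exp (Real.exp 2) ≤ d := Nat.ceil_le.1 hd
  have hd0 : (0 : ℝ) < d := (Real.exp_pos _).trans_le hdexp
  have hdpos : 0 < d := by exact_mod_cast hd0
  set x := Real.log d
  set y := Real.log x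
  have hexpx : Real.exp x = d := Real.exp_log hd0
  have hxe : Real.exp 2 ≤ x := (Real.le_log_iff_exp_le hd0).2 hdexp
  have hx0 : 0 < x := (Real.exp_pos _).trans_le hxe
  have hexpy : Real.exp y = x := Real.exp_log hx0
  have hy : 2 ≤ y := (Real.le_log_iff_exp_le hx0).2 hxe
  have hx : 4 ≤ x := by
    have h1 : (2 : ℝ) ≤ Real.exp 1 := by linarith [Real.add_one_le_exp (1 : ℝ)]
    have h2 : Real.exp 2 = Real.exp 1 * Real.exp 1 := by rw [← Real.exp_add]; norm_num
    nlinarith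
  have hγ0 : 0 < γ := lt_of_le_of_lt (by positivity) hγ
  rw [div_lt_iff₀ hx0] at hγ
  by_contra! hlt
  rw [lt_div_iff₀ hγ0] at hlt
  set k := 9 * s + 1 with hk
  have hk' : (k : ℝ) = 9 * s + 1 := by rw [hk]; push_cast; ring
  have hk1 : (1 : ℝ) ≤ k := by rw [hk']; linarith [Nat.cast_nonneg (α := ℝ) s]
  have hkγ : k * γ ≤ 11 / 24 := by rw [hk']; linarith
  have hky : k * y ≤ x / 40 := by nlinarith
  have hkx : 80 * (k : ℝ) ≤ x := by nlinarith
  set M := ⌈(d : ℝ) ^ ((1 : ℝ) + γ)⌉₊ + 1 with hMdef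
  have hpow : (d : ℝ) ^ ((1 : ℝ) + γ) = d * Real.exp (γ * x) := by
    rw [Real.rpow_add hd0, Real.rpow_one, Real.rpow_def_of_pos hd0, mul_comm γ]
  have hexp1 : 1 ≤ Real.exp (γ * x) := Real.one_le_exp (by positivity)
  have hd1 : (1 : ℝ) ≤ d := by exact_mod_cast hdpos
  have hMm : m + 1 ≤ M := by
    have : m ≤ ⌈(d : ℝ) ^ ((1 : ℝ) + γ)⌉₊ := by exact_mod_cast hm.trans (Nat.le_ceil _)
    omega
  have hMd : (d : ℝ) ≤ M := by
    have := Nat.le_ceil ((d : ℝ) ^ ((1 : ℝ) + γ))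
    rw [hMdef]; push_cast
    nlinarith
  have hMu : (M : ℝ) ≤ 3 * (d * Real.exp (γ * x)) := by
    have := (Nat.ceil_lt_add_one (show 0 ≤ (d : ℝ) ^ ((1 : ℝ) + γ) by positivity)).le
    rw [hpow] at this
    rw [hMdef]; push_cast; rw [hpow]
    nlinarith
  have hsqrt : Real.exp (x / 2) * Real.exp (x / 2) = d := by
    rw [← Real.exp_add, add_halves, hexpx]
  have hkd : (k : ℝ) ≤ Real.exp (x / 2) := by linarith [Real.add_one_le_exp (x / 2)]
  have hMd2 : (M : ℝ) ≤ 3 * (d * Real.exp (x / 2)) := by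
    refine hMu.trans ?_
    gcongr
    nlinarith
  have hMk : (4 * (M * k) : ℝ) ≤ n := by
    have h1 : (M * k : ℝ) ≤ 3 * (d * Real.exp (x / 2)) * Real.exp (x / 2) := by gcongr
    have h2 : 3 * (d * Real.exp (x / 2)) * Real.exp (x / 2) = 3 * d ^ 2 := by
      rw [mul_assoc, mul_assoc, hsqrt]; ring
    have h3 : (100 * d ^ 2 : ℝ) ≤ n := by exact_mod_cast hn
    nlinarith
  have hMkn : 4 * (M * k) ≤ n := by exact_mod_cast hMk
  have hdMk : d ≤ M * k := by
    have : d ≤ M := by exact_mod_cast hMd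
    exact this.trans (Nat.le_mul_of_pos_right _ (by omega))
  have hn0 : (0 : ℝ) < n := by
    have : 0 < n := by omega
    exact_mod_cast this
  set l := n / (2 * (M * k)) with hl
  have hcard : (M + (m + 1)) * (k * l) ≤ n :=
    calc (M + (m + 1)) * (k * l) ≤ (M + M) * (k * l) := by gcongr
      _ = n / (2 * (M * k)) * (2 * (M * k)) := by rw [← hl]; ring
      _ ≤ n := Nat.div_mul_le_self _ _
  have hr := div_le_one_sub_pow hdpos hdMk hMkn
  have hp : (d / (4 * n) : ℝ) ∈ unitInterval := by
    refine ⟨by positivity, ?_⟩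
    rw [div_le_one (by positivity)]
    have : (d : ℝ) ≤ n := by exact_mod_cast (by omega : d ≤ n)
    linarith
  have hbound := hD.le_pow_of_colSparse hs hδ hdpos (by omega) hcard ⟨_, hp⟩
    (le_of_eq (by simp only; field_simp))
  refine absurd hbound (not_le.2 (one_sub_pow_lt hx hkγ hky (hexpx ▸ hMd) ?_ ?_))
  · refine le_trans ?_ hr
    exact exp_neg_sub_le_div hd0 hexpy hx hkx hMu (by omega)
  · have : 0 ≤ (1 - d / (4 * n) : ℝ) ^ l := pow_nonneg (by linarith [hp.2]) _
    simp only
    linarith
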